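/- Let L be a Hilbert space, E : L → (-∞, +∞] weakly lower semicontinuous, α ∈ ℝ, and suppose C := {v ∈ L : E(v) ≤ α} is closed and convex with metric projection P. Let c > 0, t₁ < t₂, and U ∈ H¹([t₁, t₂], L) with U(t₁), U(t₂) ∈ C and α ≤ 0. If there exists t₃ ∈ (t₁, t₂) with E(U(t₃)) > α, then the function Ũ(t) := P(U(t)) satisfies Ũ(t₁) = U(t₁), Ũ(t₂) = U(t₂), Ũ(t) ∈ C for all t, and ∫_{t₁}^{t₂}(‖Ũ'‖²/2 + E(Ũ)) e^{ct} dt < ∫_{t₁}^{t₂}(‖U'‖²/2 + E(U)) e^{ct} dt. -/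

import Mathlib

open MeasureTheory Set intervalIntegral
open scoped NNReal Topology

lemma lip_sep {L : Type*} [NormedAddCommGroup L] [InnerProductSpace ℝ L] [CompleteSpace L]
    [TopologicalSpace.SeparableSpace L] {K : ℝ≥0} {g : ℝ → L} (hg : LipschitzWith K g) :
    ∀ᵐ t, DifferentiableAt ℝ g t := by
  obtain ⟨w, b, hb⟩ := exists_hilbertBasis ℝ L
  have hcount : Countable w := by
    refine Pairwise.countable_of_isOpen_disjoint (s := fun i : w => Metric.ball (b i) (1/2)) ?_
      (fun i => Metric.isOpen_ball) (fun i => ⟨b i, by simp⟩)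
    intro i j hij
    apply Metric.ball_disjoint_ball
    have h0 : inner ℝ (b i) (b j) = 0 := b.orthonormal.2 hij
    have h1 := b.orthonormal.1 i
    have h2 := b.orthonormal.1 j
    have h3 := norm_sub_sq_real (b i) (b j)
    rw [h0, h1, h2] at h3
    rw [dist_eq_norm]
    nlinarith [norm_nonneg (b i - b j)]
  let gi : w → ℝ → ℝ := fun i t => inner ℝ (b i) (g t)
  have hgi : ∀ i, LipschitzWith K (gi i) := by
    intro i
    refine LipschitzWith.of_dist_le_mul fun x y => ?_
    have : gi i x - gi i y = inner ℝ (b i) (g x - g y) := by simp [gi, inner_sub_right]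
    rw [Real.dist_eq, this]
    refine (abs_real_inner_le_norm _ _).trans ?_
    rw [b.orthonormal.1 i, one_mul, ← dist_eq_norm]
    exact hg.dist_le_mul x y
  have hd : ∀ᵐ t, ∀ i, DifferentiableAt ℝ (gi i) t :=
    ae_all_iff.2 fun i => (hgi i).ae_differentiableAt_real
  have hbd : ∀ t, (∀ i, DifferentiableAt ℝ (gi i) t) → ∀ F : Finset w,
      ∑ i ∈ F, ‖deriv (gi i) t‖ ^ 2 ≤ (K:ℝ) ^ 2 := by
    intro t h F
    have ht : Filter.Tendsto (fun s => ∑ i ∈ F, ‖slope (gi i) t s‖ ^ 2) (𝓝[≠] t)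
        (𝓝 (∑ i ∈ F, ‖deriv (gi i) t‖ ^ 2)) :=
      tendsto_finsetSum _ fun i _ => ((h i).hasDerivAt.tendsto_slope.norm.pow 2)
    refine le_of_tendsto ht ?_
    filter_upwards [self_mem_nhdsWithin] with s hs
    have : ∀ i, slope (gi i) t s = inner ℝ (b i) (slope g t s) := by
      intro i
      simp [slope, gi, inner_sub_right, inner_smul_right]
    simp only [this]
    refine (b.orthonormal.sum_inner_products_le _).trans ?_
    gcongr
    rw [slope, norm_smul, vsub_eq_sub, norm_inv, inv_mul_le_iff₀ (by simpa [sub_eq_zero] using hs),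
      mul_comm, ← dist_eq_norm, ← dist_eq_norm]
    exact hg.dist_le_mul s t
  have hV : ∃ V : ℝ → L, (∀ᵐ t, ‖V t‖ ≤ K ∧ HasSum (fun i => deriv (gi i) t • b i) (V t)) := by
    classical
    have hm : ∀ t, (∀ i, DifferentiableAt ℝ (gi i) t) →
        Memℓp (fun i => deriv (gi i) t) 2 := fun t ht =>
      memℓp_gen' (C := (K:ℝ)^2) (by simpa using hbd t ht)
    refine ⟨fun t => if ht : ∀ i, DifferentiableAt ℝ (gi i) t then
      b.repr.symm ⟨_, hm t ht⟩ else 0, ?_⟩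
    filter_upwards [hd] with t ht
    rw [dif_pos ht]
    constructor
    · rw [LinearIsometryEquiv.norm_map]
      refine lp.norm_le_of_forall_sum_le (by simp) (by simp) ?_
      simpa using hbd t ht
    · exact b.hasSum_repr_symm ⟨_, hm t ht⟩
  obtain ⟨V, hV⟩ := hV
  have hVm : AEStronglyMeasurable V volume := by
    refine aestronglyMeasurable_of_tendsto_ae (u := (Filter.atTop : Filter (Finset w)))
      (f := fun F t => ∑ i ∈ F, deriv (gi i) t • b i) ?_ ?_
    · intro F
      refine Finset.aestronglyMeasurable_fun_sum _ fun i _ => ?_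
      exact (aestronglyMeasurable_deriv (gi i) _).smul_const _
    · filter_upwards [hV] with t ht
      exact ht.2
  have hVi : LocallyIntegrable V volume := by
    intro x
    refine ⟨Metric.ball x 1, Metric.ball_mem_nhds _ one_pos, ?_⟩
    refine Measure.integrableOn_of_bounded (M := K) (by simp) hVm ?_
    exact ae_restrict_of_ae (hV.mono fun t ht => ht.1)
  have hVii : ∀ x y : ℝ, IntervalIntegrable V volume x y := fun x y =>
    intervalIntegrable_iff.mpr <|
      (hVi.integrableOn_isCompact isCompact_uIcc).mono_set uIoc_subset_uIcc
  have hftc : ∀ t, g t = g 0 + ∫ s in (0:ℝ)..t, V s := by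
    intro t
    suffices b.repr (g t) = b.repr (g 0 + ∫ s in (0:ℝ)..t, V s) from b.repr.injective this
    ext i
    rw [b.repr_apply_apply, b.repr_apply_apply, inner_add_right]
    have h1 : inner ℝ (b i) (∫ s in (0:ℝ)..t, V s) = ∫ s in (0:ℝ)..t, inner ℝ (b i) (V s) := by
      exact ((innerSL ℝ (b i)).intervalIntegral_comp_comm (hVii 0 t)).symm
    have h2 : ∫ s in (0:ℝ)..t, inner ℝ (b i) (V s) = ∫ s in (0:ℝ)..t, deriv (gi i) s := by
      refine intervalIntegral.integral_congr_ae ?_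
      filter_upwards [hV] with s hs _
      have h3 := hs.2.mapL (innerSL ℝ (b i))
      have h4 : HasSum (fun j => innerSL ℝ (b i) (deriv (gi j) s • b j)) (deriv (gi i) s) := by
        have h5 := hasSum_single (f := fun j => innerSL ℝ (b i) (deriv (gi j) s • b j)) i ?_
        · have h6 : innerSL ℝ (b i) (deriv (gi i) s • b i) = deriv (gi i) s := by
            simp [inner_smul_right, b.orthonormal.1 i]
          simpa only [h6] using h5
        · intro j hj
          simp [inner_smul_right, b.orthonormal.2 hj.symm]
      exact h3.unique h4
    rw [h1, h2, ((hgi i).lipschitzOnWith).absolutelyContinuousOnInterval.integral_deriv_eq_sub]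
    simp [gi]
  filter_upwards [LocallyIntegrable.ae_hasDerivAt_integral hVi] with t ht
  have := (ht 0).const_add (g 0)
  have h5 : g = fun t => g 0 + ∫ s in (0:ℝ)..t, V s := funext hftc
  rw [h5]
  exact this.differentiableAt

lemma lip_hilbert {L : Type*} [NormedAddCommGroup L] [InnerProductSpace ℝ L] [CompleteSpace L]
    {K : ℝ≥0} {g : ℝ → L} (hg : LipschitzWith K g) :
    ∀ᵐ t, DifferentiableAt ℝ g t := by
  let H : Submodule ℝ L := (Submodule.span ℝ (range g)).topologicalClosure
  have hsep : TopologicalSpace.IsSeparable (H : Set L) := by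
    rw [Submodule.topologicalClosure_coe]
    exact (TopologicalSpace.isSeparable_range hg.continuous).span.closure
  have : TopologicalSpace.SeparableSpace H := hsep.separableSpace
  have : CompleteSpace H := (Submodule.isClosed_topologicalClosure _).completeSpace_coe
  let g' : ℝ → H := fun t => ⟨g t, Submodule.le_topologicalClosure _ (Submodule.subset_span ⟨t, rfl⟩)⟩
  have hg' : LipschitzWith K g' := fun x y => hg x y
  filter_upwards [lip_sep hg'] with t ht
  exact (H.subtypeL.differentiableAt).comp t ht

lemma lip_extend {L : Type*} [NormedAddCommGroup L] [NormedSpace ℝ L]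
    {K : ℝ≥0} {f : ℝ → L} {A : Set ℝ} (hA : IsCompact A) (hne : A.Nonempty)
    (hf : LipschitzOnWith K f A) : ∃ g : ℝ → L, LipschitzWith K g ∧ EqOn g f A := by
  have hm := hA.sInf_mem hne
  have hM := hA.sSup_mem hne
  set m := sInf A with hmdef
  set M := sSup A with hMdef
  have hmM : m ≤ M := csInf_le hA.bddBelow hM
  let a : ℝ → ℝ := fun t => sSup (A ∩ Iic t)
  let b : ℝ → ℝ := fun t => sInf (A ∩ Ici t)
  have ha : ∀ t ∈ Icc m M, a t ∈ A ∧ a t ≤ t ∧ ∀ x ∈ A, x ≤ t → x ≤ a t := by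
    intro t ht
    have h := (hA.inter_right isClosed_Iic).sSup_mem ⟨m, hm, ht.1⟩
    exact ⟨h.1, h.2, fun x hx hxt =>
      le_csSup (hA.inter_right isClosed_Iic).bddAbove ⟨hx, hxt⟩⟩
  have hb : ∀ t ∈ Icc m M, b t ∈ A ∧ t ≤ b t ∧ ∀ x ∈ A, t ≤ x → b t ≤ x := by
    intro t ht
    have h := (hA.inter_right isClosed_Ici).sInf_mem ⟨M, hM, ht.2⟩
    exact ⟨h.1, h.2, fun x hx hxt =>
      csInf_le (hA.inter_right isClosed_Ici).bddBelow ⟨hx, hxt⟩⟩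
  have hfl : ∀ x ∈ A, ∀ y ∈ A, ‖f x - f y‖ ≤ K * |x - y| := by
    intro x hx y hy
    have := hf.dist_le_mul x hx y hy
    rwa [dist_eq_norm, Real.dist_eq] at this
  let g : ℝ → L := fun t => f (a t) + ((t - a t) / (b t - a t)) • (f (b t) - f (a t))
  -- slope bound
  have hslope : ∀ t ∈ Icc m M, ∀ r : ℝ, ‖(r / (b t - a t)) • (f (b t) - f (a t))‖ ≤ K * |r| := by
    intro t ht r
    have h1 := hfl _ (hb t ht).1 _ (ha t ht).1
    rcases eq_or_ne (b t - a t) 0 with h0 | h0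
    · rw [h0]; simp; positivity
    · rw [norm_smul, Real.norm_eq_abs, abs_div]
      have : 0 < |b t - a t| := abs_pos.2 h0
      rw [div_mul_eq_mul_div, div_le_iff₀ this]
      nlinarith [abs_nonneg r]
  have hga : ∀ t ∈ Icc m M, ‖g t - f (a t)‖ ≤ K * (t - a t) := by
    intro t ht
    have := hslope t ht (t - a t)
    rw [abs_of_nonneg (by linarith [(ha t ht).2.1])] at this
    simpa [g] using this
  have hgb : ∀ t ∈ Icc m M, ‖f (b t) - g t‖ ≤ K * (b t - t) := by
    intro t ht
    have := hslope t ht (b t - t)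
    rw [abs_of_nonneg (by linarith [(hb t ht).2.1])] at this
    convert this using 2
    rcases eq_or_ne (b t - a t) 0 with h0 | h0
    · have : b t = a t := by linarith
      simp [g, this]
    · have h1 : (b t - t) / (b t - a t) = 1 - (t - a t) / (b t - a t) := by
        field_simp; ring
      rw [h1, sub_smul, one_smul]
      simp only [g]; abel
  have hgA : ∀ t ∈ A, g t = f t := by
    intro t ht
    have htI : t ∈ Icc m M := ⟨csInf_le hA.bddBelow ht, le_csSup hA.bddAbove ht⟩
    have : a t = t := le_antisymm (ha t htI).2.1 ((ha t htI).2.2 t ht le_rfl)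
    simp [g, this]
  have hlt : ∀ s ∈ Icc m M, ∀ t ∈ Icc m M, s ≤ t → ‖g t - g s‖ ≤ K * (t - s) := by
    intro s hs t ht hst
    obtain ⟨ha1, ha2, ha3⟩ := ha t ht
    obtain ⟨hb1, hb2, hb3⟩ := hb s hs
    obtain ⟨ha1', ha2', ha3'⟩ := ha s hs
    obtain ⟨hb1', hb2', hb3'⟩ := hb t ht
    by_cases h : b s ≤ a t
    · have e : g t - g s = (g t - f (a t)) + (f (a t) - f (b s)) + (f (b s) - g s) := by abel
      have h3 := hfl _ ha1 _ hb1
      rw [abs_of_nonneg (by linarith)] at h3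
      rw [e]
      refine (norm_add₃_le).trans ?_
      linarith [hga t ht, hgb s hs]
    · have h1 : t < b s := by
        by_contra h'
        exact h (ha3 _ hb1 (not_lt.1 h'))
      have h2 : a t < s := by
        by_contra h'
        exact h (hb3 _ ha1 (not_lt.1 h'))
      have e1 : a t = a s := le_antisymm (ha3' _ ha1 h2.le) (ha3 _ ha1' (ha2'.trans hst))
      have e2 : b t = b s := le_antisymm (hb3' _ hb1 h1.le) (hb3 _ hb1' (hst.trans hb2'))
      have := hslope s hs (t - s)
      rw [abs_of_nonneg (by linarith)] at this
      convert this using 2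
      simp only [g, e1, e2]
      rw [show (t - s) / (b s - a s) = (t - a s) / (b s - a s) - (s - a s) / (b s - a s) by ring,
        sub_smul]
      abel
  have hgl : LipschitzOnWith K g (Icc m M) := by
    refine LipschitzOnWith.of_dist_le_mul fun x hx y hy => ?_
    rw [dist_eq_norm, Real.dist_eq]
    rcases le_total x y with h | h
    · rw [norm_sub_rev, abs_sub_comm, abs_of_nonneg (by linarith)]
      exact hlt x hx y hy h
    · rw [abs_of_nonneg (by linarith)]
      exact hlt y hy x hx h
  refine ⟨IccExtend hmM (fun x => g x), ?_, ?_⟩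
  · have h1 := (lipschitzOnWith_iff_restrict.1 hgl).comp (LipschitzWith.projIcc hmM)
    rw [mul_one] at h1
    exact h1
  · intro t ht
    have htI : t ∈ Icc m M := ⟨csInf_le hA.bddBelow ht, le_csSup hA.bddAbove ht⟩
    rw [IccExtend_of_mem _ _ htI]
    exact hgA t ht

lemma stepanov_hilbert {L : Type*} [NormedAddCommGroup L] [InnerProductSpace ℝ L]
    [CompleteSpace L] {f : ℝ → L} (hf : Continuous f) :
    ∀ᵐ t, ∀ n : ℕ, (∀ s, |s - t| < 1 / ((n:ℝ) + 1) → ‖f s - f t‖ ≤ ((n:ℝ) + 1) * |s - t|) →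
      DifferentiableAt ℝ f t := by
  rw [ae_all_iff]
  intro n
  have hn : (0:ℝ) < (n:ℝ) + 1 := by positivity
  set N : ℝ := (n:ℝ) + 1 with hN
  let A : Set ℝ := {t | ∀ s, |s - t| < 1 / N → ‖f s - f t‖ ≤ N * |s - t|}
  have hAc : IsClosed A := by
    rw [← isSeqClosed_iff_isClosed]
    intro u t hu hut s hs
    have h1 : Filter.Tendsto (fun k => |s - u k|) Filter.atTop (𝓝 |s - t|) :=
      (tendsto_const_nhds.sub hut).abs
    have h2 : Filter.Tendsto (fun k => ‖f s - f (u k)‖) Filter.atTop (𝓝 ‖f s - f t‖) :=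
      (tendsto_const_nhds.sub ((hf.tendsto t).comp hut)).norm
    refine le_of_tendsto_of_tendsto h2 (h1.const_mul N) ?_
    filter_upwards [h1.eventually (gt_mem_nhds hs)] with k hk
    exact hu k s hk
  have key : ∀ q : ℚ, ∀ᵐ t, t ∈ A ∩ Metric.closedBall (q:ℝ) (1 / (4 * N)) →
      DifferentiableAt ℝ f t := by
    intro q
    set B := A ∩ Metric.closedBall (q:ℝ) (1 / (4 * N)) with hB
    have hBc : IsCompact B := (isCompact_closedBall _ _).inter_left hAc
    rcases B.eq_empty_or_nonempty with h0 | hne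
    · simp [h0]
    have hlip : LipschitzOnWith ⟨N, hn.le⟩ f B := by
      refine LipschitzOnWith.of_dist_le_mul fun x hx y hy => ?_
      rw [dist_eq_norm, Real.dist_eq]
      refine hy.1 x ?_
      have h1 := hx.2
      have h2 := hy.2
      rw [Metric.mem_closedBall, Real.dist_eq] at h1 h2
      have h3 : |x - y| ≤ |x - q| + |y - q| := by
        rw [abs_sub_comm y]; exact abs_sub_le _ _ _
      have h4 : 1 / (4 * N) + 1 / (4 * N) < 1 / N := by
        have : 1 / (4 * N) = (1 / N) / 4 := by field_simp
        have : 0 < 1 / N := by positivity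
        linarith
      linarith
    obtain ⟨g, hg, hgf⟩ := lip_extend hBc hne hlip
    have hdist : LipschitzWith 1 (fun s : ℝ => Metric.infDist s B) :=
      Metric.lipschitz_infDist_pt B
    filter_upwards [lip_hilbert hg, hdist.ae_differentiableAt_real] with t hgt hdt htB
    have hd0 : HasDerivAt (fun s : ℝ => Metric.infDist s B) 0 t := by
      have hmin : IsLocalMin (fun s : ℝ => Metric.infDist s B) t := by
        refine Filter.Eventually.of_forall fun s => ?_
        simp only [Metric.infDist_zero_of_mem htB]
        exact Metric.infDist_nonneg
      have := hdt.hasDerivAt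
      rwa [hmin.deriv_eq_zero] at this
    have hgd := hgt.hasDerivAt
    set v := deriv g t
    refine HasDerivAt.differentiableAt (f' := v) ?_
    rw [hasDerivAt_iff_isLittleO, Asymptotics.isLittleO_iff] at hgd hd0 ⊢
    intro ε hε
    -- choose small parameter
    set η : ℝ := min 1 (ε / (4 * (N + ‖v‖))) with hη
    have hNv : 0 < N + ‖v‖ := by positivity
    have hη0 : 0 < η := lt_min one_pos (by positivity)
    have hη1 : η ≤ 1 := min_le_left _ _
    have hη2 : (N + ‖v‖) * η ≤ ε / 4 := by
      have : η ≤ ε / (4 * (N + ‖v‖)) := min_le_right _ _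
      calc (N + ‖v‖) * η ≤ (N + ‖v‖) * (ε / (4 * (N + ‖v‖))) := by gcongr
        _ = ε / 4 := by field_simp
    have hg4 := hgd (show 0 < ε / 4 by positivity)
    obtain ⟨δ, hδ, hgδ⟩ := Metric.eventually_nhds_iff.1 hg4
    filter_upwards [hd0 (show 0 < η / 2 by positivity),
      Metric.ball_mem_nhds t (show 0 < δ / 2 by positivity),
      Metric.ball_mem_nhds t (show 0 < 1 / N by positivity)] with s hs1 hs2 hs3
    rw [Metric.mem_ball, Real.dist_eq] at hs2 hs3
    rcases eq_or_ne s t with rfl | hst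
    · simp
    have hst0 : 0 < |s - t| := abs_pos.2 (sub_ne_zero.2 hst)
    have hlt : Metric.infDist s B < η * |s - t| := by
      simp only [Metric.infDist_zero_of_mem htB, sub_zero, smul_zero, Real.norm_eq_abs] at hs1
      have := le_abs_self (Metric.infDist s B)
      nlinarith [mul_pos hη0 hst0]
    obtain ⟨r, hrB, hr⟩ := (Metric.infDist_lt_iff hne).1 hlt
    rw [Real.dist_eq] at hr
    have hr1 : |s - r| ≤ |s - t| := by nlinarith
    have hrt : |r - t| ≤ 2 * |s - t| := by
      have := abs_sub_le r s t
      rw [abs_sub_comm r s] at this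
      linarith
    have e1 : ‖f s - f r‖ ≤ N * |s - r| := hrB.1 s (by linarith)
    have e2 : ‖g r - g t - (r - t) • v‖ ≤ ε / 4 * |r - t| := by
      have := @hgδ r (by rw [Real.dist_eq]; linarith)
      simpa [Real.norm_eq_abs] using this
    rw [hgf hrB, hgf htB] at e2
    have e3 : ‖(r - s) • v‖ ≤ |s - r| * ‖v‖ := by
      rw [norm_smul, Real.norm_eq_abs, abs_sub_comm]
    have e : f s - f t - (s - t) • v =
        (f s - f r) + (f r - f t - (r - t) • v) + (r - s) • v := by
      simp only [sub_smul]; abel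
    rw [e, Real.norm_eq_abs]
    refine (norm_add₃_le).trans ?_
    have e4 : (N + ‖v‖) * |s - r| ≤ ε / 4 * |s - t| := by
      calc (N + ‖v‖) * |s - r| ≤ (N + ‖v‖) * (η * |s - t|) := by gcongr
        _ = ((N + ‖v‖) * η) * |s - t| := by ring
        _ ≤ _ := by gcongr
    nlinarith
  filter_upwards [ae_all_iff.2 key] with t ht htA
  obtain ⟨q, hq⟩ := exists_rat_near t (show 0 < 1 / (4 * N) by positivity)
  exact ht q ⟨htA, by rw [Metric.mem_closedBall, Real.dist_eq]; exact hq.le⟩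

lemma proj_lip {L : Type*} [NormedAddCommGroup L] [InnerProductSpace ℝ L]
    (C : Set L) (hconv : Convex ℝ C) (P : L → L)
    (hP : ∀ x : L, P x ∈ C ∧ ∀ y ∈ C, ‖x - P x‖ ≤ ‖x - y‖) (x y : L) :
    ‖P x - P y‖ ≤ ‖x - y‖ := by
  have h : ∀ x, ∀ w ∈ C, inner ℝ (x - P x) (w - P x) ≤ 0 := by
    intro x
    refine (norm_eq_iInf_iff_real_inner_le_zero hconv (hP x).1).1 ?_
    have : Nonempty C := ⟨⟨P x, (hP x).1⟩⟩
    refine le_antisymm (le_ciInf fun w => (hP x).2 w w.2) ?_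
    exact ciInf_le (f := fun w : C => ‖x - w‖) ⟨0, by rintro _ ⟨w, rfl⟩; exact norm_nonneg _⟩
      ⟨P x, (hP x).1⟩
  have h1 := h x _ (hP y).1
  have h2 := h y _ (hP x).1
  have h3 : ‖P x - P y‖ * ‖P x - P y‖ ≤ inner ℝ (x - y) (P x - P y) := by
    rw [← real_inner_self_eq_norm_mul_norm]
    have e1 : inner ℝ (x - P x) (P y - P x) = - inner ℝ (x - P x) (P x - P y) := by
      rw [← inner_neg_right]; congr 1; abel
    have e2 : inner ℝ (x - y) (P x - P y) = inner ℝ (x - P x) (P x - P y)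
        - inner ℝ (y - P y) (P x - P y) + inner ℝ (P x - P y) (P x - P y) := by
      rw [← inner_sub_left, ← inner_add_left]; congr 1; abel
    rw [e2]; linarith
  have h4 := real_inner_le_norm (x - y) (P x - P y)
  by_contra! hlt
  nlinarith [norm_nonneg (x - y), norm_nonneg (P x - P y)]

/-- Key comparison lemma: projecting a curve onto the convex sublevel set
`C = {E ≤ α}` (with `α ≤ 0`) fixes the endpoints and strictly decreases the
weighted energy whenever the curve exits `C`. -/
theorem projection_strictly_decreases_energy
    {L : Type*} [NormedAddCommGroup L] [InnerProductSpace ℝ L] [CompleteSpace L]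
    (E : L → ℝ) (hE : LowerSemicontinuous E)
    (α : ℝ) (hα : α ≤ 0)
    (C : Set L) (hCdef : C = {v : L | E v ≤ α})
    (hclosed : IsClosed C) (hconv : Convex ℝ C) (hne : C.Nonempty)
    (P : L → L)
    (hP : ∀ x : L, P x ∈ C ∧ ∀ y ∈ C, ‖x - P x‖ ≤ ‖x - y‖)
    (c t₁ t₂ : ℝ) (hc : 0 < c) (ht : t₁ < t₂)
    (U U' : ℝ → L)
    (hcont : ContinuousOn U (Icc t₁ t₂))
    (hderiv : ∀ᵐ t ∂(volume.restrict (Ioo t₁ t₂)), HasDerivAt U (U' t) t)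
    (h₁ : U t₁ ∈ C) (h₂ : U t₂ ∈ C)
    (t₃ : ℝ) (ht₃ : t₃ ∈ Ioo t₁ t₂) (hE₃ : α < E (U t₃))
    (hint : IntervalIntegrable (fun t => (‖U' t‖ ^ 2 / 2 + E (U t)) * Real.exp (c * t))
      volume t₁ t₂) :
    P (U t₁) = U t₁ ∧ P (U t₂) = U t₂ ∧ (∀ t : ℝ, P (U t) ∈ C) ∧
    ∃ V : ℝ → L,
      (∀ᵐ t ∂(volume.restrict (Ioo t₁ t₂)),
        HasDerivAt (fun s => P (U s)) (V t) t ∧ ‖V t‖ ≤ ‖U' t‖) ∧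
      IntervalIntegrable (fun t => (‖V t‖ ^ 2 / 2 + E (P (U t))) * Real.exp (c * t))
        volume t₁ t₂ ∧
      (∫ t in t₁..t₂, (‖V t‖ ^ 2 / 2 + E (P (U t))) * Real.exp (c * t)) <
        ∫ t in t₁..t₂, (‖U' t‖ ^ 2 / 2 + E (U t)) * Real.exp (c * t) := by
  have hPl := proj_lip C hconv P hP
  have hPfix : ∀ x ∈ C, P x = x := by
    intro x hx
    have := (hP x).2 x hx
    rw [sub_self, norm_zero] at this
    exact (sub_eq_zero.1 (norm_le_zero_iff.1 this)).symm
  have hPC : ∀ x, E (P x) ≤ α := by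
    intro x
    have := (hP x).1
    rw [hCdef] at this
    exact this
  have hPE : ∀ x, E (P x) ≤ E x := by
    intro x
    by_cases hx : x ∈ C
    · rw [hPfix x hx]
    · rw [hCdef] at hx
      exact (hPC x).trans (not_le.1 hx).le
  have hPcont : Continuous P := by
    have : LipschitzWith 1 P := LipschitzWith.of_dist_le_mul fun x y => by
      simpa [dist_eq_norm] using hPl x y
    exact this.continuous
  -- a globally continuous extension of the curve
  let W : ℝ → L := IccExtend ht.le ((Icc t₁ t₂).restrict U)
  have hWc : Continuous W := (continuousOn_iff_continuous_restrict.1 hcont).Icc_extend'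
  have hWU : ∀ t ∈ Icc t₁ t₂, W t = U t := fun t h => IccExtend_of_mem _ _ h
  have hWev : ∀ t ∈ Ioo t₁ t₂, W =ᶠ[𝓝 t] U := by
    intro t h
    filter_upwards [Icc_mem_nhds h.1 h.2] with s hs using hWU s hs
  have hdiff : ∀ᵐ t ∂(volume.restrict (Ioo t₁ t₂)),
      HasDerivAt (fun s => P (U s)) (deriv (fun s => P (U s)) t) t ∧
        ‖deriv (fun s => P (U s)) t‖ ≤ ‖U' t‖ := by
    have hst := stepanov_hilbert (hPcont.comp hWc)
    filter_upwards [hderiv, ae_restrict_of_ae hst, ae_restrict_mem measurableSet_Ioo]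
      with t h1 h2 h3
    have hWt := h1.congr_of_eventuallyEq (hWev t h3)
    have hd : DifferentiableAt ℝ (P ∘ W) t := by
      obtain ⟨c, hc⟩ := hWt.isBigO_sub.bound
      obtain ⟨δ, hδ, hc⟩ := Metric.eventually_nhds_iff.1 hc
      obtain ⟨n₁, hn₁⟩ := exists_nat_one_div_lt hδ
      obtain ⟨n₂, hn₂⟩ := exists_nat_gt c
      refine h2 (max n₁ n₂) fun s hs => ?_
      have hs' : dist s t < δ := by
        rw [Real.dist_eq]
        refine hs.trans (lt_of_le_of_lt ?_ hn₁)
        gcongr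
        exact le_max_left _ _
      refine (hPl _ _).trans ((hc hs').trans ?_)
      rw [Real.norm_eq_abs]
      gcongr
      have : (n₂ : ℝ) ≤ ((max n₁ n₂ : ℕ) : ℝ) := by exact_mod_cast le_max_right _ _
      linarith
    have hd' : DifferentiableAt ℝ (fun s => P (U s)) t := by
      refine hd.congr_of_eventuallyEq ?_
      filter_upwards [hWev t h3] with s hs
      simp [hs]
    refine ⟨hd'.hasDerivAt, ?_⟩
    refine le_of_tendsto_of_tendsto hd'.hasDerivAt.tendsto_slope.norm h1.tendsto_slope.norm ?_
    refine Filter.Eventually.of_forall fun s => ?_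
    simp only [slope, vsub_eq_sub, norm_smul]
    gcongr
    exact hPl _ _
  refine ⟨hPfix _ h₁, hPfix _ h₂, fun t => (hP _).1, deriv (fun s => P (U s)), hdiff, ?_⟩
  set V := deriv (fun s => P (U s)) with hV
  have hle : ∀ᵐ t ∂(volume.restrict (Ioo t₁ t₂)),
      (‖V t‖ ^ 2 / 2 + E (P (U t))) * Real.exp (c * t) ≤
        (‖U' t‖ ^ 2 / 2 + E (U t)) * Real.exp (c * t) := by
    filter_upwards [hdiff] with t h
    have := hPE (U t)
    have := h.2
    gcongr
  have hlsc : LowerSemicontinuous (fun t => E (P (W t))) :=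
    LowerSemicontinuous.comp hE (hPcont.comp hWc)
  obtain ⟨m, hm⟩ : ∃ m : ℝ, ∀ t ∈ Icc t₁ t₂, m ≤ E (P (W t)) := by
    obtain ⟨x, hx, hmin⟩ := (hlsc.lowerSemicontinuousOn (Icc t₁ t₂)).exists_isMinOn
      ⟨t₁, left_mem_Icc.2 ht.le⟩ isCompact_Icc
    exact ⟨E (P (W x)), fun t h => hmin h⟩
  have hVint : IntervalIntegrable
      (fun t => (‖V t‖ ^ 2 / 2 + E (P (U t))) * Real.exp (c * t)) volume t₁ t₂ := by
    rw [intervalIntegrable_iff_integrableOn_Ioo_of_le ht.le] at hint ⊢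
    have hconst : IntegrableOn (fun _ : ℝ => |m| * Real.exp (c * t₂)) (Ioo t₁ t₂) :=
      integrableOn_const (by simp)
    refine Integrable.mono' (hint.norm.add hconst) ?_ ?_
    · have hmeas : Measurable (fun t => E (P (W t))) := hlsc.measurable
      have h1 : AEStronglyMeasurable
          (fun t => (‖V t‖ ^ 2 / 2 + E (P (W t))) * Real.exp (c * t))
          (volume.restrict (Ioo t₁ t₂)) := by
        have hVm : Measurable (fun t => ‖V t‖) :=
          (stronglyMeasurable_deriv (fun s => P (U s))).norm.measurable
        apply Measurable.aestronglyMeasurable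
        exact (((hVm.pow_const 2).div_const 2).add hmeas).mul
          (Real.measurable_exp.comp (measurable_id.const_mul c))
      refine h1.congr ?_
      filter_upwards [ae_restrict_mem measurableSet_Ioo] with t h
      rw [hWU t (Ioo_subset_Icc_self h)]
    · filter_upwards [hle, ae_restrict_mem measurableSet_Ioo] with t h1 h2
      have h3 := hm t (Ioo_subset_Icc_self h2)
      rw [hWU t (Ioo_subset_Icc_self h2)] at h3
      have h4 : Real.exp (c * t) ≤ Real.exp (c * t₂) := by
        have := h2.2.le
        gcongr
      have h5 := Real.exp_pos (c * t)
      simp only [Pi.add_apply]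
      rw [Real.norm_eq_abs, Real.norm_eq_abs, abs_le]
      have h6 := le_abs_self ((‖U' t‖ ^ 2 / 2 + E (U t)) * Real.exp (c * t))
      have h7 : 0 ≤ |m| * Real.exp (c * t₂) := by positivity
      refine ⟨?_, by linarith⟩
      have h8 : -(|m| * Real.exp (c * t)) ≤
          (‖V t‖ ^ 2 / 2 + E (P (U t))) * Real.exp (c * t) := by
        rw [← neg_mul]
        gcongr
        have := neg_abs_le m
        have : 0 ≤ ‖V t‖ ^ 2 / 2 := by positivity
        linarith
      have h9 : |m| * Real.exp (c * t) ≤ |m| * Real.exp (c * t₂) := by gcongr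
      have := abs_nonneg ((‖U' t‖ ^ 2 / 2 + E (U t)) * Real.exp (c * t))
      linarith
  refine ⟨hVint, ?_⟩
  refine intervalIntegral.integral_lt_integral_of_ae_le_of_measure_setOf_lt_ne_zero ht.le
    hVint hint ?_ ?_
  · rw [← restrict_Ioo_eq_restrict_Ioc]
    exact hle
  · rw [← restrict_Ioo_eq_restrict_Ioc]
    intro h0
    let O : Set ℝ := Ioo t₁ t₂ ∩ {t | α < E (W t)}
    have hOo : IsOpen O :=
      isOpen_Ioo.inter (LowerSemicontinuous.isOpen_preimage (LowerSemicontinuous.comp hE hWc) α)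
    have hOne : O.Nonempty := by
      refine ⟨t₃, ht₃, ?_⟩
      simpa [hWU t₃ (Ioo_subset_Icc_self ht₃)] using hE₃
    have hnot : ∀ᵐ t ∂(volume.restrict (Ioo t₁ t₂)), t ∉ O := by
      have h0' := measure_eq_zero_iff_ae_notMem.1 h0
      filter_upwards [h0', hdiff] with t k1 k2 k3
      apply k1
      have k4 : α < E (U t) := by
        have := k3.2
        rwa [mem_setOf_eq, hWU t (Ioo_subset_Icc_self k3.1)] at this
      have k5 := hPC (U t)
      have k6 := k2.2
      have k7 : ‖V t‖ ^ 2 ≤ ‖U' t‖ ^ 2 := by gcongr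
      exact mul_lt_mul_of_pos_right (by linarith) (Real.exp_pos _)
    rw [ae_restrict_iff' measurableSet_Ioo] at hnot
    have : volume O = 0 := by
      rw [measure_eq_zero_iff_ae_notMem]
      filter_upwards [hnot] with t k1 k2
      exact k1 k2.1 k2
    exact (hOo.measure_pos volume hOne).ne' this
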